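/- Let (ξ₀, ξ₁₂, ξ₁₃, ξ₂₃) ∈ ℂ⁴ ∖ {0} and let (W₁, W₂, W₃, W₁₂₃) ∈ ℂ⁴ satisfy the quadric relation ξ₀·W₁₂₃ = ξ₁₂·W₃ − ξ₁₃·W₂ + ξ₂₃·W₁. Then there exists a unique (z₁,z₂,z₃) ∈ ℂ³ such that W₁ = ξ₀z₁ − ξ₁₂·conj(z₂) − ξ₁₃·conj(z₃), W₂ = ξ₀z₂ + ξ₁₂·conj(z₁) − ξ₂₃·conj(z₃), W₃ = ξ₀z₃ + ξ₁₃·conj(z₁) + ξ₂₃·conj(z₂), and W₁₂₃ = ξ₂₃z₁ − ξ₁₃z₂ + ξ₁₂z₃. Moreover, writing |ξ|² = |ξ₀|²+|ξ₁₂|²+|ξ₁₃|²+|ξ₂₃|², this solution is given explicitly by z₁ = |ξ|⁻²(conj(ξ₀)W₁ + conj(ξ₂₃)W₁₂₃ + ξ₁₃·conj(W₃) + ξ₁₂·conj(W₂)), z₂ = |ξ|⁻²(conj(ξ₀)W₂ − conj(ξ₁₃)W₁₂₃ − ξ₁₂·conj(W₁) + ξ₂₃·conj(W₃)), z₃ =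 |ξ|⁻²(conj(ξ₀)W₃ + conj(ξ₁₂)W₁₂₃ − ξ₂₃·conj(W₂) − ξ₁₃·conj(W₁)). -/

import Mathlib

open Complex

/-- The system of equations expressing the spinor components `W` in terms of
`ξ` and `z = (z₁,z₂,z₃)` on the twistor space of `S⁶`. -/
def twistorEqs (ξ₀ ξ12 ξ13 ξ23 W₁ W₂ W₃ W₁₂₃ : ℂ) (z : ℂ × ℂ × ℂ) : Prop :=
  W₁ = ξ₀ * z.1 - ξ12 * (starRingEnd ℂ) z.2.1 - ξ13 * (starRingEnd ℂ) z.2.2 ∧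
  W₂ = ξ₀ * z.2.1 + ξ12 * (starRingEnd ℂ) z.1 - ξ23 * (starRingEnd ℂ) z.2.2 ∧
  W₃ = ξ₀ * z.2.2 + ξ13 * (starRingEnd ℂ) z.1 + ξ23 * (starRingEnd ℂ) z.2.1 ∧
  W₁₂₃ = ξ23 * z.1 - ξ13 * z.2.1 + ξ12 * z.2.2

/-- **Explicit form of the twistor projection.** Given `ξ ≠ 0` and `W` satisfying the
quadric relation `ξ₀W₁₂₃ = ξ₁₂W₃ − ξ₁₃W₂ + ξ₂₃W₁`, there is a unique `z ∈ ℂ³` solving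
the twistor equations, and it is given by the displayed explicit formulas. -/
theorem twistor_projection_explicit (ξ₀ ξ12 ξ13 ξ23 : ℂ)
    (hξ : ¬(ξ₀ = 0 ∧ ξ12 = 0 ∧ ξ13 = 0 ∧ ξ23 = 0))
    (W₁ W₂ W₃ W₁₂₃ : ℂ)
    (hq : ξ₀ * W₁₂₃ = ξ12 * W₃ - ξ13 * W₂ + ξ23 * W₁) :
    (∃! z : ℂ × ℂ × ℂ, twistorEqs ξ₀ ξ12 ξ13 ξ23 W₁ W₂ W₃ W₁₂₃ z) ∧
    twistorEqs ξ₀ ξ12 ξ13 ξ23 W₁ W₂ W₃ W₁₂₃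
      (((normSq ξ₀ + normSq ξ12 + normSq ξ13 + normSq ξ23 : ℝ) : ℂ)⁻¹ *
          ((starRingEnd ℂ) ξ₀ * W₁ + (starRingEnd ℂ) ξ23 * W₁₂₃
            + ξ13 * (starRingEnd ℂ) W₃ + ξ12 * (starRingEnd ℂ) W₂),
       ((normSq ξ₀ + normSq ξ12 + normSq ξ13 + normSq ξ23 : ℝ) : ℂ)⁻¹ *
          ((starRingEnd ℂ) ξ₀ * W₂ - (starRingEnd ℂ) ξ13 * W₁₂₃
            - ξ12 * (starRingEnd ℂ) W₁ + ξ23 * (starRingEnd ℂ) W₃),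
       ((normSq ξ₀ + normSq ξ12 + normSq ξ13 + normSq ξ23 : ℝ) : ℂ)⁻¹ *
          ((starRingEnd ℂ) ξ₀ * W₃ + (starRingEnd ℂ) ξ12 * W₁₂₃
            - ξ23 * (starRingEnd ℂ) W₂ - ξ13 * (starRingEnd ℂ) W₁)) := by
  have hN : ((normSq ξ₀ + normSq ξ12 + normSq ξ13 + normSq ξ23 : ℝ) : ℂ) ≠ 0 := by
    rw [ofReal_ne_zero]
    intro h
    have h₀ := normSq_nonneg ξ₀
    have h12 := normSq_nonneg ξ12
    have h13 := normSq_nonneg ξ13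
    have h23 := normSq_nonneg ξ23
    exact hξ ⟨normSq_eq_zero.1 (by linarith), normSq_eq_zero.1 (by linarith),
      normSq_eq_zero.1 (by linarith), normSq_eq_zero.1 (by linarith)⟩
  have hNdef : ((normSq ξ₀ + normSq ξ12 + normSq ξ13 + normSq ξ23 : ℝ) : ℂ) =
      ξ₀ * (starRingEnd ℂ) ξ₀ + ξ12 * (starRingEnd ℂ) ξ12 + ξ13 * (starRingEnd ℂ) ξ13
        + ξ23 * (starRingEnd ℂ) ξ23 := by
    simp only [ofReal_add, mul_conj]
  have hNconj := conj_ofReal (normSq ξ₀ + normSq ξ12 + normSq ξ13 + normSq ξ23)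
  generalize ((normSq ξ₀ + normSq ξ12 + normSq ξ13 + normSq ξ23 : ℝ) : ℂ) = N at *
  refine (and_iff_right_of_imp fun h => ⟨_, h, ?_⟩).2 ?_
  · simp only [twistorEqs, map_add, map_sub, map_mul, map_inv₀, conj_conj, hNconj]
    refine ⟨?_, ?_, ?_, ?_⟩ <;> field_simp <;> rw [hNdef]
    · linear_combination -(starRingEnd ℂ) ξ23 * hq
    · linear_combination (starRingEnd ℂ) ξ13 * hq
    · linear_combination -(starRingEnd ℂ) ξ12 * hq
    · linear_combination (starRingEnd ℂ) ξ₀ * hq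
  · rintro ⟨z₁, z₂, z₃⟩ ⟨h₁, h₂, h₃, h₁₂₃⟩
    dsimp only at h₁ h₂ h₃ h₁₂₃
    simp only [Prod.mk.injEq]
    refine ⟨?_, ?_, ?_⟩ <;>
    · rw [eq_inv_mul_iff_mul_eq₀ hN, hNdef, h₁, h₂, h₃, h₁₂₃]
      simp only [map_add, map_sub, map_mul, conj_conj]
      ring
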